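/- arXiv:2309.17062 — 3 statements merged into one kernel-verified Lean document; each statement's English description precedes it below -/
import Mathlib

section
/- Let K be a field. Define K[t]-linear maps f : ⨁_{i∈ℕ} K[t] → ⨁_{j∈ℕ} K[t] by f(ε_i) = t·e_{i+1} − e_i on standard basis vectors, and g : ⨁_{j∈ℕ} K[t] → K[t,t⁻¹] by g(e_j) = t^{−j}. Then f is injective, g is surjective, and the kernel of g equals the range of f; that is, 0 → ⨁_{i∈ℕ} K[t] → ⨁_{j∈ℕ} K[t] → K[t,t⁻¹] → 0 is a short exact sequence of K[t]-modules (a free resolution of K[t,t⁻¹] over K[t]). -/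
open Polynomial LaurentPolynomial DirectSum

noncomputable section

/-- The standard basis vector of `⨁_{i ∈ ℕ} K[t]` supported at index `i`. -/
def stdBasis (K : Type*) [Field K] (i : ℕ) : ⨁ _ : ℕ, Polynomial K :=
  DirectSum.lof (Polynomial K) ℕ (fun _ => Polynomial K) i 1

/-- The `K[t]`-linear map `f : ⨁_{i ∈ ℕ} K[t] → ⨁_{j ∈ ℕ} K[t]` determined by
`f(ε_i) = t • e_{i+1} - e_i`. -/
def resolutionMap (K : Type*) [Field K] :
    (⨁ _ : ℕ, Polynomial K) →ₗ[Polynomial K] ⨁ _ : ℕ, Polynomial K :=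
  DirectSum.toModule (Polynomial K) ℕ _ fun i =>
    LinearMap.toSpanSingleton (Polynomial K) _
      ((X : Polynomial K) • stdBasis K (i + 1) - stdBasis K i)

/-- The `K[t]`-linear map `g : ⨁_{j ∈ ℕ} K[t] → K[t,t⁻¹]` determined by `g(e_j) = T⁻ʲ`,
where `K[t,t⁻¹]` is a `K[t]`-module via the natural inclusion `K[t] → K[t,t⁻¹]`. -/
def augmentationMap (K : Type*) [Field K] :
    (⨁ _ : ℕ, Polynomial K) →ₗ[Polynomial K] LaurentPolynomial K :=
  DirectSum.toModule (Polynomial K) ℕ _ fun j =>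
    LinearMap.toSpanSingleton (Polynomial K) _ (T (-(j : ℤ)))

lemma resolutionMap_stdBasis (K : Type*) [Field K] (i : ℕ) :
    resolutionMap K (stdBasis K i) = (X : Polynomial K) • stdBasis K (i + 1) - stdBasis K i := by
  simp [resolutionMap, stdBasis, DirectSum.toModule_lof]

lemma augmentationMap_stdBasis (K : Type*) [Field K] (i : ℕ) :
    augmentationMap K (stdBasis K i) = T (-(i : ℤ)) := by
  simp [augmentationMap, stdBasis, DirectSum.toModule_lof]

lemma smul_stdBasis (K : Type*) [Field K] (i : ℕ) (p : Polynomial K) :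
    p • stdBasis K i = DirectSum.of (fun _ : ℕ => Polynomial K) i p := by
  rw [stdBasis, ← map_smul, smul_eq_mul, mul_one]; rfl

lemma poly_smul_laurent (K : Type*) [Field K] (p : Polynomial K) (q : LaurentPolynomial K) :
    p • q = toLaurent p * q := by
  rw [Algebra.smul_def, algebraMap_eq_toLaurent]

lemma stdBasis_induction (K : Type*) [Field K] {P : (⨁ _ : ℕ, Polynomial K) → Prop}
    (h0 : P 0) (h1 : ∀ (i : ℕ) (p : Polynomial K), P (p • stdBasis K i)) (h2 : ∀ x y, P x → P y → P (x + y)) (x) : P x := by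
  induction x using DirectSum.induction_on with
  | zero => exact h0
  | of i p => rw [← smul_stdBasis]; exact h1 i p
  | add x y hx hy => exact h2 x y hx hy

lemma stdBasis_apply (K : Type*) [Field K] (i j : ℕ) :
    stdBasis K i j = if i = j then 1 else 0 := by
  have h := DirectSum.of_apply (β := fun _ : ℕ => Polynomial K) (i := i) j 1
  rw [← smul_stdBasis, one_smul] at h
  rw [h]; split_ifs with hij
  · subst hij; rfl
  · rfl

lemma resolutionMap_zero_apply (K : Type*) [Field K] (x : ⨁ _ : ℕ, Polynomial K) :
    resolutionMap K x 0 = - x 0 := by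
  induction x using stdBasis_induction with
  | h0 => simp
  | h1 i p =>
    rw [map_smul, resolutionMap_stdBasis]
    simp [DirectSum.smul_apply, DirectSum.sub_apply, stdBasis_apply]
  | h2 x y hx hy => rw [map_add, DirectSum.add_apply, DirectSum.add_apply, hx, hy]; ring

lemma resolutionMap_succ_apply (K : Type*) [Field K] (x : ⨁ _ : ℕ, Polynomial K) (j : ℕ) :
    resolutionMap K x (j + 1) = X * x j - x (j + 1) := by
  induction x using stdBasis_induction with
  | h0 => simp
  | h1 i p =>
    rw [map_smul, resolutionMap_stdBasis]
    simp only [DirectSum.smul_apply, DirectSum.sub_apply, stdBasis_apply, smul_eq_mul,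
      add_left_inj]
    ring
  | h2 x y hx hy =>
    rw [map_add (resolutionMap K), DirectSum.add_apply, DirectSum.add_apply, DirectSum.add_apply, hx, hy]; ring

lemma stdBasis_shift (K : Type*) [Field K] (i k : ℕ) :
    stdBasis K i - (X ^ k : Polynomial K) • stdBasis K (i + k) ∈
      LinearMap.range (resolutionMap K) := by
  induction k with
  | zero => simp
  | succ k ih =>
    have h : (X ^ k : Polynomial K) • resolutionMap K (stdBasis K (i + k)) ∈
      LinearMap.range (resolutionMap K) := Submodule.smul_mem _ _ ⟨_, rfl⟩
    have h3 := Submodule.sub_mem _ ih h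
    rw [resolutionMap_stdBasis, smul_sub, smul_smul, ← pow_succ] at h3
    convert h3 using 1
    rw [← add_assoc]; abel

lemma exists_reduce (K : Type*) [Field K] (x : ⨁ _ : ℕ, Polynomial K) :
    ∃ N : ℕ, ∀ n ≥ N, ∃ p : Polynomial K,
      x - p • stdBasis K n ∈ LinearMap.range (resolutionMap K) := by
  induction x using stdBasis_induction with
  | h0 => exact ⟨0, fun n _ => ⟨0, by simp⟩⟩
  | h1 i p =>
    refine ⟨i, fun n hn => ⟨p * X ^ (n - i), ?_⟩⟩
    have h := Submodule.smul_mem _ p (stdBasis_shift K i (n - i))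
    rwa [smul_sub, smul_smul, Nat.add_sub_cancel' hn] at h
  | h2 x y hx hy =>
    obtain ⟨N, hN⟩ := hx
    obtain ⟨M, hM⟩ := hy
    refine ⟨max N M, fun n hn => ?_⟩
    obtain ⟨p, hp⟩ := hN n (le_trans (le_max_left _ _) hn)
    obtain ⟨q, hq⟩ := hM n (le_trans (le_max_right _ _) hn)
    refine ⟨p + q, ?_⟩
    have h := Submodule.add_mem _ hp hq
    rw [add_smul]
    convert h using 1
    abel

lemma augmentation_resolution (K : Type*) [Field K] (x : ⨁ _ : ℕ, Polynomial K) :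
    augmentationMap K (resolutionMap K x) = 0 := by
  induction x using stdBasis_induction with
  | h0 => simp
  | h1 i p =>
    rw [map_smul, map_smul, resolutionMap_stdBasis, map_sub, map_smul, augmentationMap_stdBasis,
      augmentationMap_stdBasis, poly_smul_laurent K X, toLaurent_X, ← T_add]
    have : (1 + -((i + 1 : ℕ) : ℤ)) = -(i : ℤ) := by push_cast; ring
    rw [this, sub_self, smul_zero]
  | h2 x y hx hy => rw [map_add, map_add, hx, hy, add_zero]

/-- `0 → ⨁_{i∈ℕ} K[t] → ⨁_{j∈ℕ} K[t] → K[t,t⁻¹] → 0`, with the maps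
`f(ε_i) = t·e_{i+1} − e_i` and `g(e_j) = t^{−j}`, is a short exact sequence of `K[t]`-modules:
`f` is injective, `g` is surjective and `ker g = range f`. -/
theorem free_resolution_of_laurentPolynomial (K : Type*) [Field K] :
    Function.Injective (resolutionMap K) ∧ Function.Surjective (augmentationMap K) ∧
      LinearMap.ker (augmentationMap K) = LinearMap.range (resolutionMap K) := by
  refine ⟨?_, ?_, ?_⟩
  · rw [injective_iff_map_eq_zero]
    intro x hx
    have h : ∀ j, x j = 0 := by
      intro j
      induction j with
      | zero =>
        have := resolutionMap_zero_apply K x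
        rw [hx, DirectSum.zero_apply] at this
        exact neg_eq_zero.mp this.symm
      | succ j ih =>
        have := resolutionMap_succ_apply K x j
        rw [hx, DirectSum.zero_apply, ih, mul_zero, zero_sub] at this
        exact neg_eq_zero.mp this.symm
    exact DFinsupp.ext h
  · intro q
    obtain ⟨n, p, hp⟩ := exists_T_pow q
    refine ⟨p • stdBasis K n, ?_⟩
    rw [map_smul, augmentationMap_stdBasis, poly_smul_laurent, hp, mul_T_assoc]
    simp
  · apply le_antisymm
    · intro x hx
      rw [LinearMap.mem_ker] at hx
      obtain ⟨n, hn⟩ := exists_reduce K x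
      obtain ⟨p, hp⟩ := hn n le_rfl
      obtain ⟨y, hy⟩ := id hp
      have h := augmentation_resolution K y
      rw [hy, map_sub, hx, zero_sub, neg_eq_zero, map_smul, augmentationMap_stdBasis,
        poly_smul_laurent, (isUnit_T _).mul_left_eq_zero, toLaurent_eq_zero] at h
      rwa [h, zero_smul, sub_zero] at hp
    · rintro _ ⟨y, rfl⟩
      exact augmentation_resolution K y
end
end

section
/- Let K be a field. Every K[t]-linear map from the Laurent polynomial ring K[t,t⁻¹] to the polynomial ring K[t] is zero; that is, Hom_{K[t]}(K[t,t⁻¹], K[t]) = 0. -/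
/-- Every `K[t]`-linear map `K[t,t⁻¹] → K[t]` is zero, where the Laurent
polynomial ring `K[t,t⁻¹]` is a `K[t]`-module via the natural inclusion `K[t] → K[t,t⁻¹]`:
`Hom_{K[t]}(K[t,t⁻¹], K[t]) = 0`. -/
theorem linearMap_laurentPolynomial_to_polynomial_eq_zero (K : Type*) [Field K]
    (f : LaurentPolynomial K →ₗ[Polynomial K] Polynomial K) : f = 0 := by
  refine LinearMap.ext fun p => Polynomial.ext fun d => ?_
  have h : p = (Polynomial.X ^ (d + 1) : Polynomial K) •
      (LaurentPolynomial.T (-((d + 1 : ℕ) : ℤ)) * p) := by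
    rw [Algebra.smul_def, LaurentPolynomial.algebraMap_X_pow, ← mul_assoc,
      ← LaurentPolynomial.T_add, add_neg_cancel, LaurentPolynomial.T_zero, one_mul]
  have h2 : (Polynomial.X ^ (d + 1) : Polynomial K) ∣ f p := by
    rw [h, map_smul, smul_eq_mul]
    exact dvd_mul_right _ _
  simpa using Polynomial.X_pow_dvd_iff.1 h2 d (Nat.lt_succ_self d)
end

section
/- Let K be a field. There is an isomorphism of K[t]-modules Ext¹_{K[t]}(K[t,t⁻¹], K[t]) ≅ K[[t]]/K[t], where Ext¹ is computed in the abelian category of K[t]-modules. -/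
open CategoryTheory

noncomputable section
namespace ExtLaurent
open Limits
universe u
variable {R : Type u} [CommRing R] (S : ShortComplex (ModuleCat.{u} R))

def cX : ℕ → ModuleCat.{u} R
  | 0 => S.X₂
  | 1 => S.X₁
  | _+2 => ModuleCat.of R PUnit

def cd : ∀ n, cX S (n+1) ⟶ cX S n
  | 0 => S.f
  | _+1 => 0

def cplx : ChainComplex (ModuleCat.{u} R) ℕ :=
  ChainComplex.of (cX S) (cd S) (fun n => by simp [cd])

lemma cplx_d (n : ℕ) : (cplx S).d (n+1) n = cd S n := ChainComplex.of_d ..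

lemma cplx_zero (n : ℕ) : IsZero ((cplx S).X (n+2)) :=
  ModuleCat.isZero_of_subsingleton (ModuleCat.of R PUnit)

lemma cplx_exact (hS : S.ShortExact) (n : ℕ) : (cplx S).ExactAt (n+1) := by
  rw [HomologicalComplex.exactAt_iff' _ (n + 1 + 1) (n + 1) n (by simp) (by simp)]
  cases n with
  | succ n => exact ShortComplex.exact_of_isZero_X₂ _ (cplx_zero S n)
  | zero =>
    have := hS.mono_f
    have hm : Mono ((cplx S).sc' 2 1 0).g := by
      change Mono ((cplx S).d 1 0)
      rw [cplx_d S 0]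
      exact this
    rw [ShortComplex.exact_iff_mono _ ((cplx_zero S 0).eq_of_src _ _)]
    exact hm

def res (hS : S.ShortExact) (h1 : Projective S.X₁) (h2 : Projective S.X₂) :
    ProjectiveResolution S.X₃ where
  complex := cplx S
  projective n := match n with
    | 0 => h2
    | 1 => h1
    | n+2 => (cplx_zero S n).projective
  π := (ChainComplex.toSingle₀Equiv (cplx S) S.X₃).symm ⟨S.g, by
    rw [cplx_d S 0]; exact S.zero⟩
  quasiIso := ⟨fun n => by
    cases n with
    | zero =>
      rw [ChainComplex.quasiIsoAt₀_iff, ShortComplex.quasiIso_iff_of_zeros']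
      · refine (ShortComplex.exact_and_epi_g_iff_of_iso (S₂ := S) ?_).2 ⟨hS.exact, hS.epi_g⟩
        refine ShortComplex.isoMk (Iso.refl _) (Iso.refl _) (Iso.refl _) ?_ ?_
        · exact (Category.id_comp _).trans ((cplx_d S 0).symm.trans (Category.comp_id _).symm)
        · exact (Category.id_comp _).trans (((ChainComplex.toSingle₀Equiv_symm_apply_f_zero
            (C := cplx S) (X := S.X₃) S.g _).symm).trans (Category.comp_id _).symm)
      all_goals rfl
    | succ n =>
      rw [quasiIsoAt_iff_exactAt']
      · exact cplx_exact S hS n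
      · apply ChainComplex.exactAt_succ_single_obj⟩

theorem ext1 (hS : S.ShortExact) (h1 : Projective S.X₁) (h2 : Projective S.X₂)
    (Y : ModuleCat.{u} R) (Q : Type u) [AddCommGroup Q] [Module R Q]
    (Φ : (S.X₁ →ₗ[R] Y) →ₗ[R] Q) (hs : Function.Surjective Φ)
    (hk : ∀ φ, Φ φ = 0 ↔ ∃ α : S.X₂ →ₗ[R] Y, α ∘ₗ S.f.hom = φ) :
    Nonempty ((((Ext R (ModuleCat R) 1).obj (Opposite.op S.X₃)).obj Y) ≃ₗ[R] Q) := by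
  let P := res S hS h1 h2
  let D := P.complex.linearYonedaObj R Y
  let Ψ : D.X 1 ⟶ ModuleCat.of R Q := ModuleCat.ofHom
    { toFun := fun (φ : S.X₁ ⟶ Y) => Φ φ.hom
      map_add' := fun φ ψ => by exact map_add Φ φ.hom ψ.hom
      map_smul' := fun r φ => by exact map_smul Φ r φ.hom }
  have hd : ∀ α : S.X₂ ⟶ Y, D.d 0 1 α = S.f ≫ α := by
    intro α
    change (cplx S).d 1 0 ≫ α = _
    rw [cplx_d S 0]; rfl
  have w : D.d 0 1 ≫ Ψ = 0 := by
    ext α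
    change Ψ (D.d 0 1 α) = 0
    refine (congrArg Ψ (hd α)).trans ?_
    exact (hk _).2 ⟨ModuleCat.Hom.hom (A := S.X₂) (B := Y) α, rfl⟩
  let T : ShortComplex (ModuleCat R) := ShortComplex.mk (D.d 0 1) Ψ w
  have hT : T.Exact := by
    rw [ShortComplex.moduleCat_exact_iff]
    intro x hx
    obtain ⟨α, hα⟩ := (hk (ModuleCat.Hom.hom (A := S.X₁) (B := Y) x)).1 hx
    refine ⟨ModuleCat.ofHom α, ?_⟩
    refine (hd _).trans ?_
    exact ModuleCat.hom_ext (M := S.X₁) (N := Y) hα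
  have : Epi T.g := (ModuleCat.epi_iff_surjective _).2 fun q => by
    obtain ⟨φ, hφ⟩ := hs q
    exact ⟨ModuleCat.ofHom φ, hφ⟩
  have hg : (D.sc' 0 1 2).g = 0 := by
    refine IsZero.eq_of_tgt ?_ _ _
    rw [IsZero.iff_id_eq_zero]
    ext (x : _ ⟶ _)
    exact (cplx_zero S 0).eq_of_src _ _
  let H := ShortComplex.HomologyData.ofIsColimitCokernelCofork (D.sc' 0 1 2) hg _ hT.gIsCokernel
  let i : ((Ext R (ModuleCat R) 1).obj (Opposite.op S.X₃)).obj Y ≅ ModuleCat.of R Q :=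
    P.isoExt 1 Y ≪≫ ShortComplex.homologyMapIso (D.isoSc' 0 1 2 (by simp) (by simp)) ≪≫
      H.left.homologyIso
  exact ⟨i.toLinearEquiv⟩

end ExtLaurent

namespace ExtLaurent
open Polynomial

variable (K : Type) [Field K]

def fMap : (ℕ →₀ K[X]) →ₗ[K[X]] (ℕ →₀ K[X]) :=
  Finsupp.linearCombination K[X] (fun n => Finsupp.single n 1 - Finsupp.single (n+1) X)

def gMap : (ℕ →₀ K[X]) →ₗ[K[X]] LaurentPolynomial K :=
  Finsupp.linearCombination K[X] (fun n : ℕ => (LaurentPolynomial.T (-(n:ℤ)) : LaurentPolynomial K))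

lemma fMap_single (n : ℕ) (p : K[X]) :
    fMap K (Finsupp.single n p) = Finsupp.single n p - Finsupp.single (n+1) (p * X) := by
  simp [fMap, smul_sub]

lemma gMap_single (n : ℕ) (p : K[X]) :
    gMap K (Finsupp.single n p) = Polynomial.toLaurent p * LaurentPolynomial.T (-(n:ℤ)) := by
  simp [gMap, Algebra.smul_def]

lemma fMap_zero_apply (c : ℕ →₀ K[X]) : fMap K c 0 = c 0 := by
  induction c using Finsupp.induction_linear with
  | zero => simp
  | add a b ha hb => simp [ha, hb]
  | single n p => rw [fMap_single]; simp

lemma fMap_succ_apply (c : ℕ →₀ K[X]) (n : ℕ) : fMap K c (n+1) = c (n+1) - c n * X := by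
  induction c using Finsupp.induction_linear with
  | zero => simp
  | add a b ha hb => simp [ha, hb]; ring
  | single m p =>
    rw [fMap_single]
    simp only [Finsupp.sub_apply, Finsupp.single_apply]
    by_cases h : m = n <;> simp [h]

lemma fMap_injective : Function.Injective (fMap K) := by
  rw [injective_iff_map_eq_zero]
  intro c hc
  ext1 n
  induction n with
  | zero => rw [← fMap_zero_apply, hc]
  | succ n ih =>
    have := fMap_succ_apply K c n
    rw [hc, ih] at this
    simpa using this.symm

lemma gMap_fMap (c : ℕ →₀ K[X]) : gMap K (fMap K c) = 0 := by
  induction c using Finsupp.induction_linear with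
  | zero => simp
  | add a b ha hb => simp [ha, hb]
  | single n p =>
    rw [fMap_single, map_sub, gMap_single, gMap_single, map_mul, Polynomial.toLaurent_X, mul_assoc,
      ← LaurentPolynomial.T_add]
    rw [show (1 + -((n+1 : ℕ):ℤ)) = -(n:ℤ) by push_cast; ring, sub_self]

lemma single_raise (N k : ℕ) (p : K[X]) :
    Finsupp.single N p - Finsupp.single (N+k) (p * X^k) ∈ LinearMap.range (fMap K) := by
  induction k with
  | zero => simp
  | succ k ih =>
    have h2 : fMap K (Finsupp.single (N+k) (p * X^k)) ∈ LinearMap.range (fMap K) := ⟨_, rfl⟩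
    have := add_mem ih h2
    rw [fMap_single] at this
    rw [pow_succ, ← mul_assoc, ← add_assoc]
    simpa using this

lemma exists_single (v : ℕ →₀ K[X]) :
    ∃ (N : ℕ) (p : K[X]), v - Finsupp.single N p ∈ LinearMap.range (fMap K) := by
  induction v using Finsupp.induction_linear with
  | zero => exact ⟨0, 0, by simp⟩
  | add a b ha hb =>
    obtain ⟨N, p, hp⟩ := ha
    obtain ⟨M, q, hq⟩ := hb
    refine ⟨N + M, p * X^M + q * X^N, ?_⟩
    have h1 := single_raise K N M p
    have h2 := single_raise K M N q
    rw [add_comm M N] at h2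
    have := add_mem (add_mem hp h1) (add_mem hq h2)
    rw [Finsupp.single_add]
    convert this using 1
    abel
  | single n p => exact ⟨n, p, by simp⟩

lemma fg_exact : Function.Exact (fMap K) (gMap K) := by
  intro v
  constructor
  · intro hv
    obtain ⟨N, p, c, hc⟩ := exists_single K v
    have h := gMap_fMap K c
    rw [hc, map_sub, hv, gMap_single, zero_sub, neg_eq_zero] at h
    have h3 : Polynomial.toLaurent p = 0 := by
      have := congrArg (· * LaurentPolynomial.T (N:ℤ)) h
      beta_reduce at this
      rwa [mul_assoc, ← LaurentPolynomial.T_add, neg_add_cancel, LaurentPolynomial.T_zero,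
        mul_one, zero_mul] at this
    have : p = 0 := Polynomial.toLaurent_injective (by simpa using h3)
    subst this
    exact ⟨c, by simpa using hc⟩
  · rintro ⟨c, rfl⟩
    exact gMap_fMap K c

lemma gMap_surjective : Function.Surjective (gMap K) := by
  intro f
  induction f using LaurentPolynomial.induction_on_mul_T with
  | _ f n => exact ⟨Finsupp.single n f, gMap_single K n f⟩

/-! power series -/

def psi (b : ℕ → K[X]) : PowerSeries K :=
  PowerSeries.mk fun n => (∑ i ∈ Finset.range (n+1), b i * X^i).coeff n

lemma coeff_psi (b : ℕ → K[X]) (n N : ℕ) (h : n < N) :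
    PowerSeries.coeff n (psi K b) = (∑ i ∈ Finset.range N, b i * X^i).coeff n := by
  rw [psi, PowerSeries.coeff_mk]
  obtain ⟨k, rfl⟩ : ∃ k, N = n + 1 + k := ⟨N - (n+1), by omega⟩
  rw [Finset.sum_range_add (fun i => b i * X^i) (n+1) k, coeff_add, left_eq_add, finsetSum_coeff]
  refine Finset.sum_eq_zero fun i _ => ?_
  rw [coeff_mul_X_pow', if_neg (by omega)]

lemma smul_ps (p : K[X]) (f : PowerSeries K) : p • f = (p : PowerSeries K) * f := by
  rw [Algebra.smul_def]
  congr 1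

def psiL : (ℕ → K[X]) →ₗ[K[X]] PowerSeries K where
  toFun := psi K
  map_add' a b := by
    ext n
    simp only [map_add, coeff_psi K _ n (n+1) (by omega), Pi.add_apply, add_mul,
      Finset.sum_add_distrib, coeff_add]
  map_smul' p b := by
    ext n
    rw [coeff_psi K _ n (n+1) (by omega), RingHom.id_apply, smul_ps, PowerSeries.coeff_mul]
    simp only [Pi.smul_apply, smul_eq_mul, mul_assoc]
    rw [← Finset.mul_sum, Polynomial.coeff_mul]
    refine Finset.sum_congr rfl fun ij h => ?_
    have := Finset.HasAntidiagonal.mem_antidiagonal.1 h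
    rw [coeff_psi K _ ij.2 (n+1) (by omega), Polynomial.coeff_coe]

lemma psi_surj (f : PowerSeries K) : ∃ b, psi K b = f := by
  refine ⟨fun n => C (PowerSeries.coeff n f), ?_⟩
  ext n
  rw [coeff_psi K _ n (n+1) (by omega)]
  simp [finsetSum_coeff]

lemma psi_bd (a : ℕ → K[X]) : psi K (fun n => a n - X * a (n+1)) = (a 0 : PowerSeries K) := by
  ext n
  have : ∀ N, ∑ i ∈ Finset.range N, (a i - X * a (i+1)) * X^i = a 0 - a N * X^N := by
    intro N
    induction N with
    | zero => simp
    | succ N ih => rw [Finset.sum_range_succ, ih]; ring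
  rw [coeff_psi K _ n (n+1) (by omega), this, coeff_sub, coeff_mul_X_pow', if_neg (by omega),
    Polynomial.coeff_coe, sub_zero]

lemma psi_ker (b : ℕ → K[X]) (p : K[X]) (h : psi K b = (p : PowerSeries K)) :
    ∃ a : ℕ → K[X], ∀ n, a n - X * a (n+1) = b n := by
  have : ∀ N, X^N ∣ p - ∑ i ∈ Finset.range N, b i * X^i := by
    intro N
    rw [Polynomial.X_pow_dvd_iff]
    intro d hd
    rw [coeff_sub, ← coeff_psi K b d N hd, h, Polynomial.coeff_coe, sub_self]
  choose a ha using this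
  refine ⟨a, fun n => ?_⟩
  have h1 := ha n
  have h2 := ha (n+1)
  rw [Finset.sum_range_succ] at h2
  have : (X^n : K[X]) ≠ 0 := pow_ne_zero _ X_ne_zero
  apply mul_left_cancel₀ this
  linear_combination h2 - h1

/-- the map from Hom(F, K[t]) -/
def Phi : ((ℕ →₀ K[X]) →ₗ[K[X]] K[X]) →ₗ[K[X]]
    (PowerSeries K ⧸ LinearMap.range (Algebra.linearMap (Polynomial K) (PowerSeries K))) :=
  (Submodule.mkQ _) ∘ₗ psiL K ∘ₗ
    { toFun := fun φ n => φ (Finsupp.single n 1)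
      map_add' := fun _ _ => rfl
      map_smul' := fun _ _ => rfl }

lemma Phi_surj : Function.Surjective (Phi K) := by
  intro y
  obtain ⟨f, rfl⟩ := Submodule.mkQ_surjective _ y
  obtain ⟨b, rfl⟩ := psi_surj K f
  refine ⟨Finsupp.linearCombination K[X] b, ?_⟩
  simp [Phi, psiL]

lemma algmap (p : K[X]) : algebraMap K[X] (PowerSeries K) p = (p : PowerSeries K) := by
  rw [PowerSeries.algebraMap_apply']
  simp

lemma Phi_exact (φ : (ℕ →₀ K[X]) →ₗ[K[X]] K[X]) :
    Phi K φ = 0 ↔ ∃ α : (ℕ →₀ K[X]) →ₗ[K[X]] K[X], α ∘ₗ fMap K = φ := by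
  have key : ∀ (α : (ℕ →₀ K[X]) →ₗ[K[X]] K[X]) n, (α ∘ₗ fMap K) (Finsupp.single n 1) =
      α (Finsupp.single n 1) - X * α (Finsupp.single (n+1) 1) := by
    intro α n
    rw [LinearMap.comp_apply, fMap_single, map_sub, ← smul_eq_mul X, ← map_smul]
    simp
  have e : Phi K φ = Submodule.Quotient.mk (psi K fun n => φ (Finsupp.single n 1)) := rfl
  rw [e, Submodule.Quotient.mk_eq_zero]
  constructor
  · rintro ⟨p, hp⟩
    rw [Algebra.linearMap_apply, algmap] at hp
    obtain ⟨a, ha⟩ := psi_ker K _ p hp.symm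
    refine ⟨Finsupp.linearCombination K[X] a, ?_⟩
    refine Finsupp.lhom_ext' fun n => LinearMap.ext_ring ?_
    rw [LinearMap.comp_apply (fMap K |> LinearMap.comp _), Finsupp.lsingle_apply, key,
      LinearMap.comp_apply φ, Finsupp.lsingle_apply, ← ha n]
    simp
  · rintro ⟨α, rfl⟩
    refine ⟨α (Finsupp.single 0 1), ?_⟩
    simp only [key]
    rw [psi_bd K (fun n => α (Finsupp.single n 1)), Algebra.linearMap_apply, algmap]

end ExtLaurent

/-- `Ext¹_{K[t]}(K[t,t⁻¹], K[t]) ≅ K[[t]]/K[t]` as `K[t]`-modules, where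
`Ext¹` is computed in the abelian category of `K[t]`-modules, `K[t,t⁻¹]` is a `K[t]`-module
via the inclusion `K[t] → K[t,t⁻¹]`, and `K[[t]]/K[t]` is the quotient of `K[[t]]` by the
image of the coercion `K[t] → K[[t]]`. -/
theorem ext_one_laurentPolynomial_polynomial (K : Type) [Field K] :
    Nonempty
      ((((Ext (Polynomial K) (ModuleCat (Polynomial K)) 1).obj
            (Opposite.op (ModuleCat.of (Polynomial K) (LaurentPolynomial K)))).obj
          (ModuleCat.of (Polynomial K) (Polynomial K))) ≃ₗ[Polynomial K]
        (PowerSeries K ⧸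
          LinearMap.range (Algebra.linearMap (Polynomial K) (PowerSeries K)))) := by
  exact ExtLaurent.ext1
    (ShortComplex.mk (ModuleCat.ofHom (ExtLaurent.fMap K)) (ModuleCat.ofHom (ExtLaurent.gMap K))
      (by ext1; exact LinearMap.ext (ExtLaurent.gMap_fMap K)))
    (ModuleCat.shortComplex_shortExact _ (ExtLaurent.fg_exact K) (ExtLaurent.fMap_injective K)
      (ExtLaurent.gMap_surjective K))
    ((IsProjective.iff_projective _).1
      (inferInstance : Module.Projective (Polynomial K) (ℕ →₀ Polynomial K)))
    ((IsProjective.iff_projective _).1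
      (inferInstance : Module.Projective (Polynomial K) (ℕ →₀ Polynomial K)))
    (ModuleCat.of (Polynomial K) (Polynomial K)) _ (ExtLaurent.Phi K) (ExtLaurent.Phi_surj K)
    (ExtLaurent.Phi_exact K)
end
end
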